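/- arXiv:1612.04764 — 2 statements merged into one kernel-verified Lean document; each statement's English description precedes it below -/
import Mathlib

section
/- Let (A^{•,•}, ∂, ∂̄) be a bounded double complex of finite-dimensional vector spaces over a field K. Then for every k ∈ ℤ one has Σ_{p+q=k} (dim_K H_BC^{p,q} + dim_K H_A^{p,q}) ≥ Σ_{p+q=k} (dim_K H_∂^{p,q} + dim_K H_∂̄^{p,q}). (The intermediate inequality in the proof of the Frölicher-type inequality: the Bott-Chern and Aeppli dimensions dominate the sum of the 'Hodge numbers and their conjugates' along each anti-diagonal.) -/
open LinearMap Submodule Module DirectSum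

namespace Paper

section DoubleComplex

variable (K : Type) [Field K]
variable (A : ℤ → ℤ → Type) [∀ p q, AddCommGroup (A p q)] [∀ p q, Module K (A p q)]

/-- Transport along equalities of the indices. -/
def dcCast {p q p' q' : ℤ} (h1 : p = p') (h2 : q = q') : A p q ≃ₗ[K] A p' q' := by
  subst h1; subst h2; exact LinearEquiv.refl K (A p q)

variable (d1 : ∀ p q : ℤ, A p q →ₗ[K] A (p + 1) q)
variable (d2 : ∀ p q : ℤ, A p q →ₗ[K] A p (q + 1))

/-- The operator ∂∂̄ : A^{p,q} → A^{p+1,q+1} (apply ∂̄ first, then ∂). -/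
def ddBar (p q : ℤ) : A p q →ₗ[K] A (p + 1) (q + 1) := (d1 p (q + 1)).comp (d2 p q)

/-- The image ∂∂̄(A^{p-1,q-1}) inside A^{p,q}. -/
def ddBarIm (p q : ℤ) : Submodule K (A p q) :=
  range ((dcCast K A (show p - 1 + 1 = p by ring) (show q - 1 + 1 = q by ring)).toLinearMap.comp
    (ddBar K A d1 d2 (p - 1) (q - 1)))

/-- Bott-Chern cohomology H_BC^{p,q} = (ker ∂ ∩ ker ∂̄)/∂∂̄(A^{p-1,q-1}). -/
abbrev HBC (p q : ℤ) :=
  ↥(ker (d1 p q) ⊓ ker (d2 p q)) ⧸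
    ((ddBarIm K A d1 d2 p q).comap (ker (d1 p q) ⊓ ker (d2 p q)).subtype)

noncomputable def hBC (p q : ℤ) : ℕ := finrank K (HBC K A d1 d2 p q)

/-- ∂(A^{p-1,q}) + ∂̄(A^{p,q-1}) inside A^{p,q}. -/
def aDen (p q : ℤ) : Submodule K (A p q) :=
  range ((dcCast K A (show p - 1 + 1 = p by ring) rfl).toLinearMap.comp (d1 (p - 1) q)) ⊔
  range ((dcCast K A rfl (show q - 1 + 1 = q by ring)).toLinearMap.comp (d2 p (q - 1)))

/-- Aeppli cohomology H_A^{p,q} = ker ∂∂̄ / (im ∂ + im ∂̄). -/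
abbrev HA (p q : ℤ) :=
  ↥(ker (ddBar K A d1 d2 p q)) ⧸ ((aDen K A d1 d2 p q).comap (ker (ddBar K A d1 d2 p q)).subtype)

noncomputable def hA (p q : ℤ) : ℕ := finrank K (HA K A d1 d2 p q)

/-- Column (Dolbeault) cohomology H_∂̄^{p,q}. -/
abbrev HDolb (p q : ℤ) :=
  ↥(ker (d2 p q)) ⧸
    ((range ((dcCast K A rfl (show q - 1 + 1 = q by ring)).toLinearMap.comp (d2 p (q - 1)))).comap
      (ker (d2 p q)).subtype)

noncomputable def hDolb (p q : ℤ) : ℕ := finrank K (HDolb K A d2 p q)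

/-- Row cohomology H_∂^{p,q}. -/
abbrev HRow (p q : ℤ) :=
  ↥(ker (d1 p q)) ⧸
    ((range ((dcCast K A (show p - 1 + 1 = p by ring) rfl).toLinearMap.comp (d1 (p - 1) q))).comap
      (ker (d1 p q)).subtype)

noncomputable def hRow (p q : ℤ) : ℕ := finrank K (HRow K A d1 p q)

/-- Total complex Tot^k = ⊕_{p+q=k} A^{p,q}. -/
abbrev Tot (k : ℤ) := ⨁ p : ℤ, A p (k - p)

/-- Total differential d = ∂ + ∂̄ on the total complex. -/
noncomputable def totD (k : ℤ) : Tot A k →ₗ[K] Tot A (k + 1) :=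
  DirectSum.toModule K ℤ (Tot A (k + 1)) fun p =>
    ((DirectSum.lof K ℤ (fun p' => A p' (k + 1 - p')) (p + 1)).comp
      ((dcCast K A rfl (show k - p = k + 1 - (p + 1) by ring)).toLinearMap.comp (d1 p (k - p))))
    +
    ((DirectSum.lof K ℤ (fun p' => A p' (k + 1 - p')) p).comp
      ((dcCast K A rfl (show k - p + 1 = k + 1 - p by ring)).toLinearMap.comp (d2 p (k - p))))

def totCast {k k' : ℤ} (h : k = k') : Tot A k ≃ₗ[K] Tot A k' := by
  subst h; exact LinearEquiv.refl K (Tot A k)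

/-- b_k = dim H^k(Tot, d). -/
noncomputable def bNum (k : ℤ) : ℕ :=
  finrank K
    (↥(ker (totD K A d1 d2 k)) ⧸
      ((range ((totCast K A (show k - 1 + 1 = k by ring)).toLinearMap.comp
        (totD K A d1 d2 (k - 1)))).comap (ker (totD K A d1 d2 k)).subtype))

/-- The ∂∂̄-lemma: ker ∂ ∩ ker ∂̄ ∩ (im ∂ + im ∂̄) ⊆ im ∂∂̄ in each bidegree. -/
def DDbarLemma : Prop :=
  ∀ p q : ℤ, (ker (d1 p q) ⊓ ker (d2 p q)) ⊓ aDen K A d1 d2 p q ≤ ddBarIm K A d1 d2 p q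

end DoubleComplex

/-- The map between sub-quotients induced by the identity. -/
def qMap (K : Type) [Field K] {V : Type} [AddCommGroup V] [Module K V]
    {N1 N2 M1 M2 : Submodule K V} (hN : N1 ≤ N2) (hM : M1 ≤ M2) :
    (↥N1 ⧸ M1.comap N1.subtype) →ₗ[K] (↥N2 ⧸ M2.comap N2.subtype) :=
  Submodule.mapQ _ _ (Submodule.inclusion hN) (by
    intro x hx
    simp only [Submodule.mem_comap, Submodule.coe_subtype] at hx ⊢
    simpa using hM hx)

section SComplex

variable (K : Type) [Field K]
variable (A : ℤ → Type) [∀ k, AddCommGroup (A k)] [∀ k, Module K (A k)]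

def sCast {k k' : ℤ} (h : k = k') : A k ≃ₗ[K] A k' := by
  subst h; exact LinearEquiv.refl K (A k)

variable (d : ∀ k : ℤ, A k →ₗ[K] A (k + 1))
variable (dl : ∀ k : ℤ, A k →ₗ[K] A (k - 1))

/-- The degree-0 operator dδ : A^k → A^k (apply δ first, then d). -/
def dDelta (k : ℤ) : A k →ₗ[K] A k :=
  (sCast K A (show k - 1 + 1 = k by ring)).toLinearMap.comp ((d (k - 1)).comp (dl k))

/-- Symplectic-type Bott-Chern cohomology H_BC^k = (ker d ∩ ker δ)/dδ(A^k). -/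
abbrev HBCs (k : ℤ) :=
  ↥(ker (d k) ⊓ ker (dl k)) ⧸
    ((range (dDelta K A d dl k)).comap (ker (d k) ⊓ ker (dl k)).subtype)

noncomputable def hBCs (k : ℤ) : ℕ := finrank K (HBCs K A d dl k)

/-- d(A^{k-1}) + δ(A^{k+1}) inside A^k. -/
def sDen (k : ℤ) : Submodule K (A k) :=
  range ((sCast K A (show k - 1 + 1 = k by ring)).toLinearMap.comp (d (k - 1))) ⊔
  range ((sCast K A (show k + 1 - 1 = k by ring)).toLinearMap.comp (dl (k + 1)))

/-- Symplectic-type Aeppli cohomology H_A^k = ker dδ / (im d + im δ). -/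
abbrev HAs (k : ℤ) :=
  ↥(ker (dDelta K A d dl k)) ⧸ ((sDen K A d dl k).comap (ker (dDelta K A d dl k)).subtype)

noncomputable def hAs (k : ℤ) : ℕ := finrank K (HAs K A d dl k)

/-- H_d^k = ker d / im d. -/
abbrev Hds (k : ℤ) :=
  ↥(ker (d k)) ⧸
    ((range ((sCast K A (show k - 1 + 1 = k by ring)).toLinearMap.comp (d (k - 1)))).comap
      (ker (d k)).subtype)

noncomputable def hds (k : ℤ) : ℕ := finrank K (Hds K A d k)

/-- H_δ^k = ker δ / im δ. -/
abbrev Hdls (k : ℤ) :=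
  ↥(ker (dl k)) ⧸
    ((range ((sCast K A (show k + 1 - 1 = k by ring)).toLinearMap.comp (dl (k + 1)))).comap
      (ker (dl k)).subtype)

noncomputable def hdls (k : ℤ) : ℕ := finrank K (Hdls K A dl k)

/-- The dδ-lemma: ker d ∩ ker δ ∩ (im d + im δ) ⊆ im dδ in each degree. -/
def DDeltaLemma : Prop :=
  ∀ k : ℤ, (ker (d k) ⊓ ker (dl k)) ⊓ sDen K A d dl k ≤ range (dDelta K A d dl k)

/-- The strip double complex B^{p,q} = A^{p-q}. -/
abbrev strip (p q : ℤ) := A (p - q)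

/-- ∂ on the strip double complex, given by d. -/
def stripD1 (p q : ℤ) : strip A p q →ₗ[K] strip A (p + 1) q :=
  (sCast K A (show p - q + 1 = p + 1 - q by ring)).toLinearMap.comp (d (p - q))

/-- ∂̄ on the strip double complex, given by δ. -/
def stripD2 (p q : ℤ) : strip A p q →ₗ[K] strip A p (q + 1) :=
  (sCast K A (show p - q - 1 = p - (q + 1) by ring)).toLinearMap.comp (dl (p - q))

end SComplex

section Subquotients

variable {K V : Type} [Field K] [AddCommGroup V] [Module K V] [FiniteDimensional K V]

theorem finrank_subquotient_add (N M : Submodule K V) (h : M ≤ N) :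
    finrank K (↥N ⧸ M.comap N.subtype) + finrank K M = finrank K N := by
  rw [← (Submodule.comapSubtypeEquivOfLe h).finrank_eq]
  exact Submodule.finrank_quotient_add_finrank _

theorem finrank_le_finrank_subquotient_add (N M : Submodule K V) :
    finrank K N ≤ finrank K (↥N ⧸ M.comap N.subtype) + finrank K M := by
  rw [← Submodule.finrank_quotient_add_finrank (M.comap N.subtype)]
  gcongr
  rw [LinearEquiv.finrank_eq
    (Submodule.equivMapOfInjective N.subtype N.injective_subtype (M.comap N.subtype))]
  exact Submodule.finrank_mono (Submodule.map_comap_le _ _)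

/-- If `Z` contains both kernels and `B` lies in both images, the Bott-Chern and Aeppli type
subquotients dominate the two ordinary cohomologies. -/
theorem finrank_subquotient_add_le (K₁ K₂ I₁ I₂ B Z : Submodule K V) (h₁ : I₁ ≤ K₁) (h₂ : I₂ ≤ K₂)
    (hB : B ≤ I₁ ⊓ I₂) (hZ : K₁ ⊔ K₂ ≤ Z) :
    finrank K (↥K₁ ⧸ I₁.comap K₁.subtype) + finrank K (↥K₂ ⧸ I₂.comap K₂.subtype) ≤
      finrank K (↥(K₁ ⊓ K₂) ⧸ B.comap (K₁ ⊓ K₂).subtype) +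
        finrank K (↥Z ⧸ (I₁ ⊔ I₂).comap Z.subtype) := by
  have e₁ := finrank_subquotient_add K₁ I₁ h₁
  have e₂ := finrank_subquotient_add K₂ I₂ h₂
  have e₃ := finrank_le_finrank_subquotient_add (K₁ ⊓ K₂) B
  have e₄ := finrank_le_finrank_subquotient_add Z (I₁ ⊔ I₂)
  have e₅ := Submodule.finrank_mono hB
  have e₆ := Submodule.finrank_mono hZ
  have e₇ := Submodule.finrank_sup_add_finrank_inf_eq K₁ K₂
  have e₈ := Submodule.finrank_sup_add_finrank_inf_eq I₁ I₂
  omega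

end Subquotients

section Cast

variable {K : Type} [Field K]
variable {A : ℤ → ℤ → Type} [∀ p q, AddCommGroup (A p q)] [∀ p q, Module K (A p q)]
variable (d1 : ∀ p q : ℤ, A p q →ₗ[K] A (p + 1) q)
variable (d2 : ∀ p q : ℤ, A p q →ₗ[K] A p (q + 1))

theorem d1_dcCast {p q p' q' : ℤ} (hp : p = p') (hq : q = q') (x : A p q) :
    d1 p' q' (dcCast K A hp hq x) = dcCast K A (congrArg (· + 1) hp) hq (d1 p q x) := by
  subst hp hq; rfl

theorem d2_dcCast {p q p' q' : ℤ} (hp : p = p') (hq : q = q') (x : A p q) :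
    d2 p' q' (dcCast K A hp hq x) = dcCast K A hp (congrArg (· + 1) hq) (d2 p q x) := by
  subst hp hq; rfl

theorem dcCast_dcCast {p q p' q' p'' q'' : ℤ} (hp : p = p') (hq : q = q') (hp' : p' = p'')
    (hq' : q' = q'') (x : A p q) :
    dcCast K A hp' hq' (dcCast K A hp hq x) = dcCast K A (hp.trans hp') (hq.trans hq') x := by
  subst hp hq hp' hq'; rfl

/-- The inequality already holds in each bidegree. -/
theorem hRow_add_hDolb_le [∀ p q, FiniteDimensional K (A p q)]
    (hd1d1 : ∀ (p q : ℤ) (x : A p q), d1 (p + 1) q (d1 p q x) = 0)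
    (hd2d2 : ∀ (p q : ℤ) (x : A p q), d2 p (q + 1) (d2 p q x) = 0)
    (hanti : ∀ (p q : ℤ) (x : A p q), d1 p (q + 1) (d2 p q x) + d2 (p + 1) q (d1 p q x) = 0)
    (p q : ℤ) :
    hRow K A d1 p q + hDolb K A d2 p q ≤ hBC K A d1 d2 p q + hA K A d1 d2 p q := by
  apply finrank_subquotient_add_le
  · rintro _ ⟨x, rfl⟩
    simp [d1_dcCast, hd1d1]
  · rintro _ ⟨x, rfl⟩
    simp [d2_dcCast, hd2d2]
  · rintro _ ⟨x, rfl⟩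
    refine ⟨⟨dcCast K A rfl (by ring) (d2 (p - 1) (q - 1) x), ?_⟩,
      ⟨dcCast K A (by ring) rfl (-d1 (p - 1) (q - 1) x), ?_⟩⟩
    · simp [ddBar, d1_dcCast, dcCast_dcCast]
    · simp [ddBar, d2_dcCast, dcCast_dcCast, eq_neg_of_add_eq_zero_left (hanti _ _ x)]
  · refine sup_le (fun x hx => ?_) (fun x hx => ?_)
    · have hx' : d1 p q x = 0 := hx
      simpa [ddBar, hx'] using hanti p q x
    · have hx' : d2 p q x = 0 := hx
      simp [ddBar, hx']

end Cast

theorem BC_A_dominate_hodge (K : Type) [Field K]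
    (A : ℤ → ℤ → Type) [∀ p q, AddCommGroup (A p q)] [∀ p q, Module K (A p q)]
    [∀ p q, FiniteDimensional K (A p q)]
    (d1 : ∀ p q : ℤ, A p q →ₗ[K] A (p + 1) q)
    (d2 : ∀ p q : ℤ, A p q →ₗ[K] A p (q + 1))
    (hbdd : {pq : ℤ × ℤ | Nontrivial (A pq.1 pq.2)}.Finite)
    (hd1d1 : ∀ (p q : ℤ) (x : A p q), d1 (p + 1) q (d1 p q x) = 0)
    (hd2d2 : ∀ (p q : ℤ) (x : A p q), d2 p (q + 1) (d2 p q x) = 0)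
    (hanti : ∀ (p q : ℤ) (x : A p q), d1 p (q + 1) (d2 p q x) + d2 (p + 1) q (d1 p q x) = 0) :
    ∀ k : ℤ,
      ∑ᶠ p : ℤ, (hRow K A d1 p (k - p) + hDolb K A d2 p (k - p)) ≤
        ∑ᶠ p : ℤ, (hBC K A d1 d2 p (k - p) + hA K A d1 d2 p (k - p)) := by
  intro k
  have hfin : {p : ℤ | Nontrivial (A p (k - p))}.Finite :=
    hbdd.preimage (f := fun p : ℤ => (p, k - p)) fun a _ b _ h => congrArg Prod.fst h
  rw [finsum_eq_sum_of_support_subset (s := hfin.toFinset) _ fun p hp => ?_,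
    finsum_eq_sum_of_support_subset (s := hfin.toFinset) _ fun p hp => ?_]
  · exact Finset.sum_le_sum fun p _ => hRow_add_hDolb_le d1 d2 hd1d1 hd2d2 hanti p (k - p)
  all_goals
    rw [hfin.coe_toFinset]
    by_contra h
    have := not_nontrivial_iff_subsingleton.mp h
    apply hp
  · simp [hBC, hA, finrank_zero_of_subsingleton]
  · simp [hRow, hDolb, finrank_zero_of_subsingleton]

end Paper
end

section
/- Let (A^{•,•}, ∂, ∂̄) be a bounded double complex of finite-dimensional vector spaces over a field K. Then for every k ∈ ℤ one has Σ_{p+q=k} dim_K H_∂̄^{p,q} ≥ b_k and Σ_{p+q=k} dim_K H_∂^{p,q} ≥ b_k. (The Frölicher inequality in its algebraic, double-complex form.) -/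
open LinearMap Submodule Module DirectSum

namespace Paper

section FiniteDirectSum

variable {K : Type} [Field K]

theorem finrank_subquotient {U V W : Type} [AddCommGroup U] [Module K U] [AddCommGroup V]
    [Module K V] [AddCommGroup W] [Module K W] [FiniteDimensional K V]
    (f : U →ₗ[K] V) (g : V →ₗ[K] W) (h : ∀ x, g (f x) = 0) :
    finrank K (↥(ker g) ⧸ (range f).comap (ker g).subtype) + finrank K (range f) +
      finrank K (range g) = finrank K V := by
  have hle : range f ≤ ker g := by
    rintro _ ⟨x, rfl⟩
    exact h x
  have h1 := Submodule.finrank_quotient_add_finrank ((range f).comap (ker g).subtype)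
  have h2 := (Submodule.comapSubtypeEquivOfLe hle).finrank_eq
  have h3 := LinearMap.finrank_range_add_finrank_ker g
  omega

theorem finrank_range_equiv_comp {U V W : Type} [AddCommGroup U] [Module K U] [AddCommGroup V]
    [Module K V] [AddCommGroup W] [Module K W] (f : U →ₗ[K] V) (e : V ≃ₗ[K] W) :
    finrank K (range (e.toLinearMap.comp f)) = finrank K (range f) := by
  rw [LinearMap.range_comp]
  exact LinearEquiv.finrank_map_eq e _

variable {V : ℤ → Type} [∀ p, AddCommGroup (V p)] [∀ p, Module K (V p)]

/-- A direct sum whose terms outside `S` vanish is the product of the terms in `S`. -/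
noncomputable def directSumEquivPi (S : Finset ℤ) (hS : ∀ p ∉ S, Subsingleton (V p)) :
    (⨁ p, V p) ≃ₗ[K] ((p : S) → V p) :=
  LinearEquiv.ofBijective (LinearMap.pi fun p : S => DirectSum.component K ℤ V p) <| by
    constructor
    · rw [injective_iff_map_eq_zero]
      intro x hx
      ext p
      by_cases hp : p ∈ S
      · exact congrFun hx ⟨p, hp⟩
      · have := hS p hp
        exact Subsingleton.elim _ _
    · intro y
      refine ⟨DirectSum.mk V S y, ?_⟩
      ext p
      exact DFinsupp.mk_of_mem p.2

theorem finiteDimensional_directSum [∀ p, FiniteDimensional K (V p)] (S : Finset ℤ)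
    (hS : ∀ p ∉ S, Subsingleton (V p)) : FiniteDimensional K (⨁ p, V p) :=
  Module.Finite.equiv (directSumEquivPi (K := K) S hS).symm

theorem finrank_directSum_eq_sum [∀ p, FiniteDimensional K (V p)] (S : Finset ℤ)
    (hS : ∀ p ∉ S, Subsingleton (V p)) :
    finrank K (⨁ p, V p) = ∑ p ∈ S, finrank K (V p) := by
  rw [(directSumEquivPi (K := K) S hS).finrank_eq, Module.finrank_pi_fintype,
    Finset.sum_coe_sort S fun p => finrank K (V p)]

/-- The rank of a filtered map is at least the rank of its leading part; the filtration is given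
by the function `s`. -/
theorem sum_finrank_range_le [∀ p, FiniteDimensional K (V p)] {U : ℤ → Type}
    [∀ p, AddCommGroup (U p)] [∀ p, Module K (U p)] {W : Type} [AddCommGroup W] [Module K W]
    (S : Finset ℤ) (hS : ∀ p ∉ S, Subsingleton (V p)) (f : (⨁ p, V p) →ₗ[K] W)
    (g : ∀ p, V p →ₗ[K] U p) (s : ℤ → ℤ)
    (hfg : ∀ x, f x = 0 → ∀ p, (∀ p', s p' < s p → x p' = 0) → g p (x p) = 0) :
    ∑ p ∈ S, finrank K (range (g p)) ≤ finrank K (range f) := by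
  have := finiteDimensional_directSum (K := K) S hS
  choose C hC using fun p => (ker (g p)).exists_isCompl
  have hrank (p : ℤ) : finrank K (range (g p)) = finrank K (C p) := by
    have h1 := LinearMap.finrank_range_add_finrank_ker (g p)
    have h2 := Submodule.finrank_add_eq_of_isCompl (hC p)
    omega
  have hCS : ∀ p ∉ S, Subsingleton (C p) := fun p hp => by
    have := hS p hp
    infer_instance
  let i : (⨁ p, C p) →ₗ[K] ⨁ p, V p := DFinsupp.mapRange.linearMap fun p => (C p).subtype
  have hi (x : ⨁ p, C p) (p : ℤ) : i x p = (x p : V p) := rfl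
  have hinj : Function.Injective (f.rangeRestrict.comp i) := by
    rw [injective_iff_map_eq_zero]
    intro x hx
    have hx : f (i x) = 0 := congrArg Subtype.val hx
    classical
    by_contra hne
    have hsupp : (DFinsupp.support x).Nonempty := by
      rw [Finset.nonempty_iff_ne_empty]
      exact fun h => hne (DFinsupp.support_eq_empty.mp h)
    obtain ⟨p, hp, hmin⟩ := Finset.exists_min_image _ s hsupp
    have hg : g p (i x p) = 0 := by
      refine hfg _ hx p fun p' hp' => ?_
      by_contra hxp
      refine absurd (hmin p' ?_) (not_le.mpr hp')
      rw [DFinsupp.mem_support_iff]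
      intro h0
      exact hxp (by rw [hi]; exact congrArg Subtype.val h0)
    have h0 : (x p : V p) = 0 :=
      Submodule.disjoint_def.mp (hC p).disjoint _ hg (x p).2
    exact DFinsupp.mem_support_iff.mp hp (Subtype.ext h0)
  calc ∑ p ∈ S, finrank K (range (g p)) = finrank K (⨁ p, C p) := by
        rw [finrank_directSum_eq_sum S hCS]
        exact Finset.sum_congr rfl fun p _ => hrank p
    _ ≤ finrank K (range f) := LinearMap.finrank_le_finrank_of_injective hinj

end FiniteDirectSum

section TotalComplex

variable {K : Type} [Field K]
variable {A : ℤ → ℤ → Type} [∀ p q, AddCommGroup (A p q)] [∀ p q, Module K (A p q)]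
variable (d1 : ∀ p q : ℤ, A p q →ₗ[K] A (p + 1) q)
variable (d2 : ∀ p q : ℤ, A p q →ₗ[K] A p (q + 1))

variable (K A) in
/-- The inclusion of `A p q` into the total complex in degree `k = p + q`. -/
noncomputable def totOf (k p q : ℤ) (h : q = k - p) : A p q →ₗ[K] Tot A k :=
  (DirectSum.lof K ℤ (fun p' => A p' (k - p')) p).comp (dcCast K A rfl h).toLinearMap

theorem totD_totOf (k p q : ℤ) (h : q = k - p) (x : A p q) :
    totD K A d1 d2 k (totOf K A k p q h x) =
      totOf K A (k + 1) (p + 1) q (by omega) (d1 p q x) +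
        totOf K A (k + 1) p (q + 1) (by omega) (d2 p q x) := by
  subst h
  simp [totD, totOf, dcCast, DirectSum.toModule_lof]

theorem totD_apply_add_one (k p : ℤ) (x : Tot A k) :
    totD K A d1 d2 k x (p + 1) =
      dcCast K A rfl (show k - p = k + 1 - (p + 1) by ring) (d1 p (k - p) (x p)) +
      dcCast K A rfl (show k - (p + 1) + 1 = k + 1 - (p + 1) by ring)
        (d2 (p + 1) (k - (p + 1)) (x (p + 1))) := by
  induction x using DirectSum.induction_on with
  | zero => simp
  | add x y hx hy =>
    simp only [map_add, DirectSum.add_apply, hx, hy]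
    abel
  | of i v =>
    rw [← DirectSum.lof_eq_of K]
    simp only [totD, DirectSum.toModule_lof, LinearMap.add_apply, LinearMap.comp_apply,
      DirectSum.add_apply]
    by_cases h1 : i = p
    · subst h1
      simp [DirectSum.lof_eq_of, DirectSum.of_eq_of_ne]
    · by_cases h2 : i = p + 1
      · subst h2
        simp [DirectSum.lof_eq_of, DirectSum.of_eq_of_ne]
      · have h3 : p + 1 ≠ i + 1 := by omega
        simp [DirectSum.lof_eq_of, DirectSum.of_eq_of_ne, Ne.symm h1, Ne.symm h2, h3]

variable {d1 d2}

theorem totD_totD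
    (hd1d1 : ∀ (p q : ℤ) (x : A p q), d1 (p + 1) q (d1 p q x) = 0)
    (hd2d2 : ∀ (p q : ℤ) (x : A p q), d2 p (q + 1) (d2 p q x) = 0)
    (hanti : ∀ (p q : ℤ) (x : A p q), d1 p (q + 1) (d2 p q x) + d2 (p + 1) q (d1 p q x) = 0)
    (k : ℤ) (x : Tot A k) : totD K A d1 d2 (k + 1) (totD K A d1 d2 k x) = 0 := by
  induction x using DirectSum.induction_on with
  | zero => simp
  | add x y hx hy => simp [hx, hy]
  | of p v =>
    have hv : DirectSum.of (fun p => A p (k - p)) p v = totOf K A k p (k - p) rfl v := rfl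
    simp only [hv, totD_totOf, map_add, hd1d1, hd2d2, map_zero, zero_add, add_zero]
    rw [← map_add, add_comm (d2 (p + 1) (k - p) _)]
    simp only [hanti, map_zero]

theorem totD_totCast_totD
    (hd1d1 : ∀ (p q : ℤ) (x : A p q), d1 (p + 1) q (d1 p q x) = 0)
    (hd2d2 : ∀ (p q : ℤ) (x : A p q), d2 p (q + 1) (d2 p q x) = 0)
    (hanti : ∀ (p q : ℤ) (x : A p q), d1 p (q + 1) (d2 p q x) + d2 (p + 1) q (d1 p q x) = 0)
    {k k' : ℤ} (h : k' + 1 = k) (x : Tot A k') :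
    totD K A d1 d2 k (totCast K A h (totD K A d1 d2 k' x)) = 0 := by
  subst h
  exact totD_totD hd1d1 hd2d2 hanti k' x

theorem d1_dcCast_d1 (hd1d1 : ∀ (p q : ℤ) (x : A p q), d1 (p + 1) q (d1 p q x) = 0)
    {p p' q : ℤ} (h : p' + 1 = p) (x : A p' q) :
    d1 p q (dcCast K A h rfl (d1 p' q x)) = 0 := by
  subst h
  exact hd1d1 p' q x

theorem d2_dcCast_d2 (hd2d2 : ∀ (p q : ℤ) (x : A p q), d2 p (q + 1) (d2 p q x) = 0)
    {p q q' : ℤ} (h : q' + 1 = q) (x : A p q') :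
    d2 p q (dcCast K A rfl h (d2 p q' x)) = 0 := by
  subst h
  exact hd2d2 p q' x

variable (d1 d2) in
theorem sum_finrank_range_d2_le [∀ p q, FiniteDimensional K (A p q)] (k : ℤ) (S : Finset ℤ)
    (hS : ∀ p ∉ S, Subsingleton (A p (k - p))) :
    ∑ p ∈ S, finrank K (range (d2 p (k - p))) ≤ finrank K (range (totD K A d1 d2 k)) := by
  refine sum_finrank_range_le S hS _ _ id fun x hx p hlt => ?_
  obtain ⟨r, rfl⟩ : ∃ r, p = r + 1 := ⟨p - 1, by ring⟩
  have h := totD_apply_add_one d1 d2 k r x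
  rw [hx, hlt r (by simp)] at h
  simpa using h.symm

variable (d1 d2) in
theorem sum_finrank_range_d1_le [∀ p q, FiniteDimensional K (A p q)] (k : ℤ) (S : Finset ℤ)
    (hS : ∀ p ∉ S, Subsingleton (A p (k - p))) :
    ∑ p ∈ S, finrank K (range (d1 p (k - p))) ≤ finrank K (range (totD K A d1 d2 k)) := by
  refine sum_finrank_range_le S hS _ _ Neg.neg fun x hx p hlt => ?_
  have h := totD_apply_add_one d1 d2 k p x
  rw [hx, hlt (p + 1) (by simp)] at h
  simpa using h.symm

theorem hDolb_add [∀ p q, FiniteDimensional K (A p q)]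
    (hd2d2 : ∀ (p q : ℤ) (x : A p q), d2 p (q + 1) (d2 p q x) = 0) (p q : ℤ) :
    hDolb K A d2 p q + finrank K (range (d2 p (q - 1))) + finrank K (range (d2 p q)) =
      finrank K (A p q) := by
  rw [hDolb, ← finrank_range_equiv_comp (d2 p (q - 1))
    (dcCast K A rfl (show q - 1 + 1 = q by ring))]
  exact finrank_subquotient _ _ fun x => d2_dcCast_d2 hd2d2 _ x

theorem hRow_add [∀ p q, FiniteDimensional K (A p q)]
    (hd1d1 : ∀ (p q : ℤ) (x : A p q), d1 (p + 1) q (d1 p q x) = 0) (p q : ℤ) :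
    hRow K A d1 p q + finrank K (range (d1 (p - 1) q)) + finrank K (range (d1 p q)) =
      finrank K (A p q) := by
  rw [hRow, ← finrank_range_equiv_comp (d1 (p - 1) q)
    (dcCast K A (show p - 1 + 1 = p by ring) rfl)]
  exact finrank_subquotient _ _ fun x => d1_dcCast_d1 hd1d1 _ x

theorem bNum_add (hd1d1 : ∀ (p q : ℤ) (x : A p q), d1 (p + 1) q (d1 p q x) = 0)
    (hd2d2 : ∀ (p q : ℤ) (x : A p q), d2 p (q + 1) (d2 p q x) = 0)
    (hanti : ∀ (p q : ℤ) (x : A p q), d1 p (q + 1) (d2 p q x) + d2 (p + 1) q (d1 p q x) = 0)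
    (k : ℤ) [FiniteDimensional K (Tot A k)] :
    bNum K A d1 d2 k + finrank K (range (totD K A d1 d2 (k - 1))) +
      finrank K (range (totD K A d1 d2 k)) = finrank K (Tot A k) := by
  rw [bNum, ← finrank_range_equiv_comp (totD K A d1 d2 (k - 1))
    (totCast K A (show k - 1 + 1 = k by ring))]
  exact finrank_subquotient _ _ fun x => totD_totCast_totD hd1d1 hd2d2 hanti _ x

end TotalComplex

theorem frolicher_inequality (K : Type) [Field K]
    (A : ℤ → ℤ → Type) [∀ p q, AddCommGroup (A p q)] [∀ p q, Module K (A p q)]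
    [∀ p q, FiniteDimensional K (A p q)]
    (d1 : ∀ p q : ℤ, A p q →ₗ[K] A (p + 1) q)
    (d2 : ∀ p q : ℤ, A p q →ₗ[K] A p (q + 1))
    (hbdd : {pq : ℤ × ℤ | Nontrivial (A pq.1 pq.2)}.Finite)
    (hd1d1 : ∀ (p q : ℤ) (x : A p q), d1 (p + 1) q (d1 p q x) = 0)
    (hd2d2 : ∀ (p q : ℤ) (x : A p q), d2 p (q + 1) (d2 p q x) = 0)
    (hanti : ∀ (p q : ℤ) (x : A p q), d1 p (q + 1) (d2 p q x) + d2 (p + 1) q (d1 p q x) = 0) :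
    ∀ k : ℤ,
      bNum K A d1 d2 k ≤ ∑ᶠ p : ℤ, hDolb K A d2 p (k - p) ∧
      bNum K A d1 d2 k ≤ ∑ᶠ p : ℤ, hRow K A d1 p (k - p) := by
  intro k
  let P : Finset ℤ := hbdd.toFinset.image Prod.fst
  let S : Finset ℤ := P ∪ P.image (· + 1)
  have hP (p q : ℤ) (hp : p ∉ P) : Subsingleton (A p q) := by
    by_contra h
    rw [not_subsingleton_iff_nontrivial] at h
    exact hp (Finset.mem_image.mpr ⟨(p, q), hbdd.mem_toFinset.mpr h, rfl⟩)
  have hS (p q : ℤ) (hp : p ∉ S) : Subsingleton (A p q) :=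
    hP p q fun h => hp (Finset.mem_union_left _ h)
  have := finiteDimensional_directSum (K := K) S fun p hp => hS p (k - p) hp
  have hb := bNum_add hd1d1 hd2d2 hanti k
  rw [finrank_directSum_eq_sum S fun p hp => hS p (k - p) hp] at hb
  constructor
  · have hadd (p : ℤ) : hDolb K A d2 p (k - p) + finrank K (range (d2 p (k - 1 - p))) +
        finrank K (range (d2 p (k - p))) = finrank K (A p (k - p)) := by
      rw [← hDolb_add hd2d2, show k - 1 - p = k - p - 1 by ring]
    rw [finsum_eq_sum_of_support_subset (s := S)]
    · have h0 := sum_finrank_range_d2_le d1 d2 k S fun p hp => hS p _ hp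
      have h1 := sum_finrank_range_d2_le d1 d2 (k - 1) S fun p hp => hS p _ hp
      have h2 := Finset.sum_congr (rfl : S = S) fun p _ => hadd p
      simp only [Finset.sum_add_distrib] at h2
      omega
    · intro p hp
      by_contra h
      have := hS p (k - p) h
      have h0 : finrank K (A p (k - p)) = 0 := finrank_zero_of_subsingleton
      have h1 := hadd p
      exact hp (by dsimp only; omega)
  · have hadd (p : ℤ) : hRow K A d1 p (k - p) + finrank K (range (d1 (p - 1) (k - p))) +
        finrank K (range (d1 p (k - p))) = finrank K (A p (k - p)) := hRow_add hd1d1 _ _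
    rw [finsum_eq_sum_of_support_subset (s := S)]
    · have h0 := sum_finrank_range_d1_le d1 d2 k S fun p hp => hS p _ hp
      have h1 := sum_finrank_range_d1_le d1 d2 (k - 1) P fun p hp => hP p _ hp
      have h2 := Finset.sum_congr (rfl : S = S) fun p _ => hadd p
      -- `d1` out of column `p - 1` vanishes unless `p - 1 ∈ P`
      have h3 : ∑ p ∈ S, finrank K (range (d1 (p - 1) (k - p))) =
          ∑ p ∈ P, finrank K (range (d1 p (k - 1 - p))) := by
        rw [← Finset.sum_subset (Finset.subset_union_right : P.image (· + 1) ⊆ S),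
          Finset.sum_image fun _ _ _ _ h => add_right_cancel h]
        · refine Finset.sum_congr rfl fun p _ => ?_
          rw [show p + 1 - 1 = p by ring, show k - (p + 1) = k - 1 - p by ring]
        · intro p _ hp
          have := hP (p - 1) (k - p) fun h => hp (Finset.mem_image.mpr ⟨p - 1, h, by ring⟩)
          have h4 := LinearMap.finrank_range_le (d1 (p - 1) (k - p))
          rw [finrank_zero_of_subsingleton (R := K) (M := A (p - 1) (k - p))] at h4
          omega
      simp only [Finset.sum_add_distrib] at h2
      omega
    · intro p hp
      by_contra h
      have := hS p (k - p) h
      have h0 : finrank K (A p (k - p)) = 0 := finrank_zero_of_subsingleton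
      have h1 := hadd p
      exact hp (by dsimp only; omega)

end Paper
end
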